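/- Let φ : M_d(C) → M_d(C) be linear and k ∈ {1,…,d}. Then φ is k-positive if and only if for all orthogonal projections E, F of rank k on C^d, the map x ↦ F φ(E x E) F is completely positive. -/

import Mathlib

open scoped Matrix ComplexOrder

/-- A map `φ : M_ι(ℂ) → M_ι(ℂ)` is `k`-positive if `φ ⊗ id_{M_k(ℂ)}` is positive. -/
def kPositive {ι : Type} [Fintype ι] [DecidableEq ι] (k : ℕ)
    (φ : Matrix ι ι ℂ → Matrix ι ι ℂ) : Prop :=
  ∀ X : Matrix (ι × Fin k) (ι × Fin k) ℂ, X.PosSemidef →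
    Matrix.PosSemidef (Matrix.of fun p q : ι × Fin k =>
      φ (Matrix.of fun i j : ι => X (i, p.2) (j, q.2)) p.1 q.1)

/-- A map is completely positive if it is `k`-positive for all `k`. -/
def CompletelyPositive {ι : Type} [Fintype ι] [DecidableEq ι]
    (φ : Matrix ι ι ℂ → Matrix ι ι ℂ) : Prop :=
  ∀ k : ℕ, kPositive k φ

namespace Matrix

/-- The sum over `r, s` of `zᵣ* φ(wᵣ wₛ*) zₛ`, where `wᵣ` and `zᵣ` are the columns of `W` and `Z`. -/
def amplifiedForm {ι κ : Type*} [Fintype ι] [Fintype κ]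
    (φ : Matrix ι ι ℂ → Matrix ι ι ℂ) (W Z : Matrix ι κ ℂ) : ℂ :=
  ∑ r, ∑ s, star (Z.col r) ⬝ᵥ (φ (vecMulVec (W.col r) (star (W.col s))) *ᵥ Z.col s)

theorem amplifiedForm_mul {ι κ μ : Type*} [Fintype ι] [Fintype κ] [Fintype μ]
    (φ : Matrix ι ι ℂ →ₗ[ℂ] Matrix ι ι ℂ) (W : Matrix ι κ ℂ) (A : Matrix κ μ ℂ)
    (Z : Matrix ι μ ℂ) :
    amplifiedForm φ (W * A) Z = amplifiedForm φ W (Z * Aᴴ) := by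
  have hL (r s : μ) : vecMulVec ((W * A).col r) (star ((W * A).col s)) =
      ∑ t, ∑ u, (A t r * star (A u s)) • vecMulVec (W.col t) (star (W.col u)) := by
    ext i j
    simp only [vecMulVec_apply, col_apply, mul_apply, Pi.star_apply, star_sum, star_mul,
      Finset.sum_mul_sum, sum_apply, smul_apply, smul_eq_mul]
    exact Finset.sum_congr rfl fun t _ => Finset.sum_congr rfl fun u _ => by ring
  have hR (t : κ) : (Z * Aᴴ).col t = ∑ r, star (A t r) • Z.col r := by
    ext i
    simp [mul_apply, Finset.sum_apply, mul_comm]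
  simp only [amplifiedForm, hL, hR, map_sum, map_smul, star_sum, star_smul, star_star,
    sum_mulVec, mulVec_sum, smul_mulVec, mulVec_smul, sum_dotProduct, dotProduct_sum,
    smul_dotProduct, dotProduct_smul, smul_eq_mul, Finset.mul_sum]
  simp only [← Fintype.sum_prod_type']
  refine Fintype.sum_equiv
    ⟨fun p => (p.2.2.1, p.2.2.2, p.2.1, p.1), fun q => (q.2.2.2, q.2.2.1, q.1, q.2.1),
      fun _ => rfl, fun _ => rfl⟩ _ _ fun p => ?_
  simp only [Equiv.coe_fn_mk]
  ring

theorem amplifiedForm_compress {ι κ : Type*} [Fintype ι] [Fintype κ]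
    (φ : Matrix ι ι ℂ → Matrix ι ι ℂ) {E F : Matrix ι ι ℂ} (hE : E.IsHermitian)
    (hF : F.IsHermitian) (W Z : Matrix ι κ ℂ) :
    amplifiedForm (fun x => F * φ (E * x * E) * F) W Z = amplifiedForm φ (E * W) (F * Z) := by
  have hcol (A : Matrix ι ι ℂ) (B : Matrix ι κ ℂ) (r : κ) : (A * B).col r = A *ᵥ B.col r := rfl
  simp only [amplifiedForm, hcol, star_mulVec, hE.eq, hF.eq, ← mul_vecMulVec, ← vecMulVec_mul,
    ← mulVec_mulVec, ← dotProduct_mulVec, Matrix.mul_assoc]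

theorem posSemidef_iff_forall_dotProduct_mulVec_nonneg {n : Type*} [Fintype n]
    [DecidableEq n] {M : Matrix n n ℂ} :
    M.PosSemidef ↔ ∀ x : n → ℂ, 0 ≤ star x ⬝ᵥ (M *ᵥ x) := by
  refine ⟨fun h => h.dotProduct_mulVec_nonneg, fun h => .of_dotProduct_mulVec_nonneg ?_ h⟩
  rw [← isSymmetric_toEuclideanLin_iff, LinearMap.isSymmetric_iff_inner_map_self_real]
  intro v
  have hv : inner ℂ v (toEuclideanLin M v) = star v.ofLp ⬝ᵥ (M *ᵥ v.ofLp) := by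
    simp [EuclideanSpace.inner_eq_star_dotProduct, dotProduct_comm]
  rw [inner_conj_symm, hv, ← inner_conj_symm, hv]
  exact (Complex.conj_eq_iff_im.2 (Complex.le_def.1 (h _)).2.symm).symm

theorem dotProduct_blocks_mulVec {ι κ : Type*} [Fintype ι] [Fintype κ]
    (M : κ → κ → Matrix ι ι ℂ) (Z : Matrix ι κ ℂ) :
    star (fun p : ι × κ => Z p.1 p.2) ⬝ᵥ
        ((of fun p q : ι × κ => M p.2 q.2 p.1 q.1) *ᵥ fun p => Z p.1 p.2) =
      ∑ r, ∑ s, star (Z.col r) ⬝ᵥ (M r s *ᵥ Z.col s) := by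
  simp only [dotProduct, mulVec, Pi.star_apply, of_apply, col_apply, Fintype.sum_prod_type_right,
    Finset.mul_sum]
  exact Finset.sum_congr rfl fun r _ => Finset.sum_comm

theorem exists_eq_mul_of_rank_eq {m n : Type*} [Fintype m] [Fintype n] [DecidableEq n] {k : ℕ}
    {K : Type*} [Field K] (A : Matrix m n K) (hA : A.rank = k) :
    ∃ (V : Matrix m (Fin k) K) (B : Matrix (Fin k) n K), A = V * B := by
  let b := Module.finBasisOfFinrankEq K (LinearMap.range A.mulVecLin) hA
  let c (j : n) : LinearMap.range A.mulVecLin := ⟨A.mulVecLin (Pi.single j 1), _, rfl⟩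
  refine ⟨of fun i l => (b l : m → K) i, of fun l j => b.repr (c j) l, ?_⟩
  ext i j
  have h := congrArg (fun x : LinearMap.range A.mulVecLin => (x : m → K) i) (b.sum_repr (c j))
  simp only [c, Submodule.coe_sum, Submodule.coe_smul, Finset.sum_apply, Pi.smul_apply,
    smul_eq_mul, mulVecLin_apply, mulVec_single_one, col_apply] at h
  simp [mul_apply, ← h, c, mul_comm]

theorem exists_isometry_mul_conjTranspose_mul_eq {d k : ℕ} (hkd : k ≤ d)
    (W : Matrix (Fin d) (Fin k) ℂ) :
    ∃ V : Matrix (Fin d) (Fin k) ℂ, Vᴴ * V = 1 ∧ V * Vᴴ * W = W := by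
  let f (i : Fin d) : EuclideanSpace ℂ (Fin d) :=
    if h : (i : ℕ) < k then WithLp.toLp 2 (W.col ⟨i, h⟩) else 0
  have hd : Module.finrank ℂ (EuclideanSpace ℂ (Fin d)) = Fintype.card (Fin d) := by simp
  let b := InnerProductSpace.gramSchmidtOrthonormalBasis hd f
  let V : Matrix (Fin d) (Fin k) ℂ := of fun i j => b (Fin.castLE hkd j) i
  have hVW (j c : Fin k) : (Vᴴ * W) j c = inner ℂ (b (Fin.castLE hkd j)) (f (Fin.castLE hkd c)) := by
    simp [V, f, mul_apply, EuclideanSpace.inner_eq_star_dotProduct, dotProduct, mul_comm]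
  refine ⟨V, ?_, ?_⟩
  · ext i j
    have h := orthonormal_iff_ite.1 b.orthonormal (Fin.castLE hkd i) (Fin.castLE hkd j)
    simpa [V, mul_apply, one_apply, EuclideanSpace.inner_eq_star_dotProduct, dotProduct,
      mul_comm] using h
  · ext i c
    have h := congrArg (fun v : EuclideanSpace ℂ (Fin d) => v i)
      (b.sum_repr' (f (Fin.castLE hkd c)))
    rw [Matrix.mul_assoc, mul_apply]
    simp only [hVW]
    have hz : ∀ j ∉ Set.range (Fin.castLE hkd),
        inner ℂ (b j) (f (Fin.castLE hkd c)) * b j i = 0 := by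
      intro j hj
      rw [InnerProductSpace.gramSchmidtOrthonormalBasis_inv_triangular, zero_mul]
      by_contra hlt
      exact hj ⟨⟨j, lt_of_le_of_lt (not_lt.1 hlt) c.2⟩, rfl⟩
    calc _ = ∑ j, inner ℂ (b j) (f (Fin.castLE hkd c)) * b j i :=
          Fintype.sum_of_injective _ (Fin.castLE_injective hkd) _ _ hz
            fun j => by simp [V, mul_comm]
      _ = W i c := by simpa [f] using h

theorem exists_projection_rank_eq_mul_eq {d k : ℕ} (hkd : k ≤ d)
    (W : Matrix (Fin d) (Fin k) ℂ) :
    ∃ E : Matrix (Fin d) (Fin d) ℂ, E.IsHermitian ∧ E * E = E ∧ E.rank = k ∧ E * W = W := by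
  obtain ⟨V, hV, hW⟩ := exists_isometry_mul_conjTranspose_mul_eq hkd W
  refine ⟨V * Vᴴ, isHermitian_mul_conjTranspose_self V, ?_, ?_, hW⟩
  · rw [Matrix.mul_assoc, ← Matrix.mul_assoc Vᴴ, hV, Matrix.one_mul]
  · rw [rank_self_mul_conjTranspose, ← rank_conjTranspose_mul_self, hV, rank_one, Fintype.card_fin]

end Matrix

open Matrix in
open scoped MatrixOrder in
theorem kPositive_iff_amplifiedForm_nonneg {ι : Type} [Fintype ι] [DecidableEq ι] (k : ℕ)
    (φ : Matrix ι ι ℂ →ₗ[ℂ] Matrix ι ι ℂ) :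
    kPositive k (fun x => φ x) ↔ ∀ W Z : Matrix ι (Fin k) ℂ, 0 ≤ amplifiedForm φ W Z := by
  refine ⟨fun h W Z => ?_, fun h X hX => ?_⟩
  · have := (h _ (posSemidef_vecMulVec_self_star fun p : ι × Fin k => W p.1 p.2)
      ).dotProduct_mulVec_nonneg fun p => Z p.1 p.2
    rwa [dotProduct_blocks_mulVec (fun r s => φ (of fun i j =>
      vecMulVec (fun p : ι × Fin k => W p.1 p.2) (star fun p => W p.1 p.2) (i, r) (j, s)))] at this
  · obtain ⟨B, rfl⟩ := CStarAlgebra.nonneg_iff_eq_star_mul_self.mp hX.nonneg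
    refine posSemidef_iff_forall_dotProduct_mulVec_nonneg.2 fun x => ?_
    let W (a : ι × Fin k) : Matrix ι (Fin k) ℂ := of fun i r => star (B a (i, r))
    let Z : Matrix ι (Fin k) ℂ := of fun i r => x (i, r)
    have hB (r s : Fin k) : (of fun i j => (star B * B) (i, r) (j, s)) =
        ∑ a, vecMulVec ((W a).col r) (star ((W a).col s)) := by
      ext i j
      simp [W, mul_apply, Matrix.sum_apply, vecMulVec_apply, star_apply]
    have hx : 0 ≤ ∑ a, amplifiedForm φ (W a) Z := Finset.sum_nonneg fun a _ => h _ _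
    refine hx.trans_eq (.trans ?_ (dotProduct_blocks_mulVec
      (fun r s => φ (of fun i j => (star B * B) (i, r) (j, s))) Z).symm)
    simp only [hB, map_sum, sum_mulVec, dotProduct_sum, amplifiedForm]
    rw [Finset.sum_comm]
    exact Finset.sum_congr rfl fun r _ => Finset.sum_comm

/-- A linear map `φ` on `M_d(ℂ)` is `k`-positive iff for all orthogonal projections `E`, `F`
of rank `k` the map `x ↦ F φ(E x E) F` is completely positive. -/
theorem kPositive_iff_two_sided_compress_cp {d : ℕ}
    (φ : Matrix (Fin d) (Fin d) ℂ →ₗ[ℂ] Matrix (Fin d) (Fin d) ℂ)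
    (k : ℕ) (hk1 : 1 ≤ k) (hkd : k ≤ d) :
    kPositive k (fun x => φ x) ↔
      ∀ E F : Matrix (Fin d) (Fin d) ℂ,
        E.IsHermitian → E * E = E → E.rank = k →
        F.IsHermitian → F * F = F → F.rank = k →
        CompletelyPositive (fun x => F * φ (E * x * E) * F) := by
  have hcomp (m : ℕ) {E F : Matrix (Fin d) (Fin d) ℂ} (hE : E.IsHermitian) (hF : F.IsHermitian) :
      kPositive m (fun x => F * φ (E * x * E) * F) ↔
        ∀ W Z : Matrix (Fin d) (Fin m) ℂ, 0 ≤ Matrix.amplifiedForm φ (E * W) (F * Z) := by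
    simp only [← Matrix.amplifiedForm_compress φ hE hF]
    exact kPositive_iff_amplifiedForm_nonneg m
      (LinearMap.mulRight ℂ F ∘ₗ LinearMap.mulLeft ℂ F ∘ₗ φ ∘ₗ
        LinearMap.mulRight ℂ E ∘ₗ LinearMap.mulLeft ℂ E)
  rw [kPositive_iff_amplifiedForm_nonneg]
  refine ⟨fun h E F hE _ hEk hF _ _ m => (hcomp m hE hF).2 fun W Z => ?_, fun h W Z => ?_⟩
  · obtain ⟨V, B, rfl⟩ := E.exists_eq_mul_of_rank_eq hEk
    rw [Matrix.mul_assoc, Matrix.amplifiedForm_mul]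
    exact h _ _
  · obtain ⟨E, hE, hEE, hEk, hEW⟩ := Matrix.exists_projection_rank_eq_mul_eq hkd W
    obtain ⟨F, hF, hFF, hFk, hFZ⟩ := Matrix.exists_projection_rank_eq_mul_eq hkd Z
    simpa only [hEW, hFZ] using (hcomp k hE hF).1 (h E F hE hEE hEk hF hFF hFk k) W Z
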